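/- Let g ≥ 1 be an integer, let r, k be positive integers, and let d be a positive divisor of gcd(r,k). Then (1/d^{2g}) · (r^g/(r+k)^g) · Σ_{δ | d} n_g(δ) · v_{δ(g−1)+1}(r/δ, k/δ) = r^g · (r+k)^{(r−1)(g−1)−1} · Σ_{S ⊆ {1,…,r+k}, |S| = r} (gcd(δ_S, d)/d)^{2g} · Π_{(s,t) ∈ S×S, s ≠ t} |2 sin((s−t)π/(r+k))|^{1−g}, where δ_S denotes the largest coperiod of S and the product is over ordered pairs of distinct elements of S. -/

import Mathlib

open Finset Real
open scoped Classical

/-- The Verlinde number `v_g(r,k)`. -/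
noncomputable def verlinde (g r k : ℕ) : ℝ :=
  ((r : ℝ) + k) ^ (r * (g - 1)) *
    ∑ S ∈ (Finset.Icc 1 (r + k)).powersetCard r,
      ∏ p ∈ (S ×ˢ S).filter (fun p => p.1 ≠ p.2),
        |2 * Real.sin (((p.1 : ℝ) - (p.2 : ℝ)) * Real.pi / ((r : ℝ) + k))| ^ (1 - (g : ℤ))

/-- `n_g(δ) = δ^{2g} · ∏_{p prime, p ∣ δ} (1 − p^{−2g})`. -/
noncomputable def jordanCount (g δ : ℕ) : ℝ :=
  (δ : ℝ) ^ (2 * g) * ∏ p ∈ δ.primeFactors, (1 - (p : ℝ) ^ (-(2 * (g : ℤ))))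

/-- `δ` is a coperiod of `S`. -/
def IsCoperiod (r k δ : ℕ) (S : Finset ℕ) : Prop :=
  δ ∣ Nat.gcd r k ∧
    ∃ T ⊆ Finset.Icc 1 ((r + k) / δ), T.card = r / δ ∧
      S = (Finset.range δ).biUnion (fun i => T.image (fun s => s + i * ((r + k) / δ)))

/-- The largest coperiod `δ_S` of `S`; coperiods divide `gcd(r,k)`, hence are bounded. -/
noncomputable def largestCoperiod (r k : ℕ) (S : Finset ℕ) : ℕ :=
  Nat.findGreatest (fun δ => IsCoperiod r k δ S) (Nat.gcd r k)

/-! ### The Jordan totient -/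

theorem jordanCount_mul_of_coprime (g : ℕ) {a b : ℕ} (h : a.Coprime b) :
    jordanCount g (a * b) = jordanCount g a * jordanCount g b := by
  simp only [jordanCount]
  rw [h.primeFactors_mul, prod_union h.disjoint_primeFactors]
  push_cast
  ring

theorem jordanCount_one (g : ℕ) : jordanCount g 1 = 1 := by
  simp [jordanCount]

theorem jordanCount_prime_pow_succ (g : ℕ) {p : ℕ} (hp : p.Prime) (i : ℕ) :
    jordanCount g (p ^ (i + 1)) = ((p : ℝ) ^ (i + 1)) ^ (2 * g) - ((p : ℝ) ^ i) ^ (2 * g) := by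
  have hp0 : (p : ℝ) ≠ 0 := by exact_mod_cast hp.ne_zero
  have hz : (p : ℝ) ^ (-(2 * (g : ℤ))) = ((p : ℝ) ^ (2 * g))⁻¹ := by
    rw [zpow_neg]
    norm_cast
  rw [jordanCount, Nat.primeFactors_prime_pow (Nat.succ_ne_zero i) hp, prod_singleton, hz]
  push_cast
  rw [mul_sub, mul_one, pow_succ (p : ℝ) i, mul_pow, mul_assoc,
    mul_inv_cancel₀ (pow_ne_zero _ hp0), mul_one]

theorem sum_divisors_jordanCount {g : ℕ} (hg : 1 ≤ g) (m : ℕ) :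
    ∑ δ ∈ m.divisors, jordanCount g δ = (m : ℝ) ^ (2 * g) := by
  let J : ArithmeticFunction ℝ := ⟨jordanCount g, by simp [jordanCount]; omega⟩
  let P : ArithmeticFunction ℝ := ⟨fun m => (m : ℝ) ^ (2 * g), by simp; omega⟩
  have hJ : J.IsMultiplicative := ⟨jordanCount_one g, fun h => jordanCount_mul_of_coprime g h⟩
  have hP : P.IsMultiplicative := ⟨by simp [P], fun _ => by simp [P, mul_pow]⟩
  have key : J * (ArithmeticFunction.zeta : ArithmeticFunction ℝ) = P := by
    rw [(hJ.mul ArithmeticFunction.isMultiplicative_zeta.natCast).eq_iff_eq_on_prime_powers _ _ hP]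
    intro p i hp
    rw [ArithmeticFunction.coe_mul_zeta_apply, Nat.sum_divisors_prime_pow hp]
    change ∑ j ∈ range (i + 1), jordanCount g (p ^ j) = ((p ^ i : ℕ) : ℝ) ^ (2 * g)
    induction i with
    | zero => simp [jordanCount_one]
    | succ i ih =>
      rw [sum_range_succ, ih, jordanCount_prime_pow_succ g hp]
      push_cast
      ring
  calc ∑ δ ∈ m.divisors, jordanCount g δ
      = (J * (ArithmeticFunction.zeta : ArithmeticFunction ℝ)) m :=
        (ArithmeticFunction.coe_mul_zeta_apply (f := J)).symm
    _ = (m : ℝ) ^ (2 * g) := by rw [key]; rfl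

/-! ### Products of sines over cosets of roots of unity -/

theorem abs_two_mul_sin_sub (x y : ℝ) :
    |2 * Real.sin (x - y)| =
      ‖Complex.exp (2 * x * Complex.I) - Complex.exp (2 * y * Complex.I)‖ := by
  have h : Complex.exp (2 * x * Complex.I) - Complex.exp (2 * y * Complex.I) =
      Complex.exp ((2 * y : ℝ) * Complex.I) *
        (Complex.exp (Complex.I * ((2 * (x - y) : ℝ) : ℂ)) - 1) := by
    rw [mul_sub, ← Complex.exp_add, mul_one]
    push_cast
    ring_nf
  rw [h, norm_mul, Complex.norm_exp_ofReal_mul_I, one_mul, Complex.norm_exp_I_mul_ofReal_sub_one,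
    Real.norm_eq_abs]
  congr 3
  ring

theorem Complex.exp_two_mul_div_mul_pi (δ j : ℕ) :
    Complex.exp (2 * ((j * Real.pi / δ : ℝ) : ℂ) * Complex.I) =
      Complex.exp (2 * Real.pi * Complex.I / δ) ^ j := by
  rw [← Complex.exp_nat_mul]
  push_cast
  ring_nf

theorem Polynomial.X_pow_sub_one_eq_prod_range {ζ : ℂ} {δ : ℕ} (hδ : 0 < δ)
    (hζ : IsPrimitiveRoot ζ δ) :
    (Polynomial.X ^ δ - 1 : Polynomial ℂ) =
      ∏ j ∈ range δ, (Polynomial.X - Polynomial.C (ζ ^ j)) := by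
  simpa using X_pow_sub_C_eq_prod hζ hδ (one_pow δ)

theorem prod_range_abs_two_mul_sin_sub {δ : ℕ} (hδ : 0 < δ) (y : ℝ) :
    ∏ j ∈ range δ, |2 * Real.sin (y - j * Real.pi / δ)| = |2 * Real.sin (δ * y)| := by
  have hζ := Complex.isPrimitiveRoot_exp δ hδ.ne'
  have h := congrArg (Polynomial.eval (Complex.exp (2 * y * Complex.I)))
    (Polynomial.X_pow_sub_one_eq_prod_range hδ hζ)
  simp only [Polynomial.eval_prod, Polynomial.eval_sub, Polynomial.eval_pow, Polynomial.eval_X,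
    Polynomial.eval_one, Polynomial.eval_C] at h
  simp only [abs_two_mul_sin_sub, Complex.exp_two_mul_div_mul_pi]
  rw [← norm_prod, ← h, ← sub_zero ((δ : ℝ) * y), abs_two_mul_sin_sub, ← Complex.exp_nat_mul]
  congr 2
  · push_cast
    ring_nf
  · simp

theorem prod_range_erase_abs_two_mul_sin {δ i : ℕ} (hi : i < δ) :
    ∏ j ∈ (range δ).erase i, |2 * Real.sin (i * Real.pi / δ - j * Real.pi / δ)| = δ := by
  have hδ : 0 < δ := by omega
  have hζ := Complex.isPrimitiveRoot_exp δ hδ.ne'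
  simp only [abs_two_mul_sin_sub, Complex.exp_two_mul_div_mul_pi]
  generalize Complex.exp (2 * Real.pi * Complex.I / δ) = ζ at hζ
  have h := congrArg (fun P => Polynomial.eval (ζ ^ i) (Polynomial.derivative P))
    (Polynomial.X_pow_sub_one_eq_prod_range hδ hζ)
  simp only [Polynomial.derivative_prod_finset, Polynomial.eval_finsetSum] at h
  rw [sum_eq_single_of_mem i (mem_range.2 hi)] at h
  · simp only [Polynomial.derivative_sub, Polynomial.derivative_X_pow, Polynomial.derivative_one,
      Polynomial.derivative_X, Polynomial.derivative_C, sub_zero, mul_one, Polynomial.eval_prod,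
      Polynomial.eval_sub, Polynomial.eval_X, Polynomial.eval_C, Polynomial.eval_mul,
      Polynomial.eval_pow] at h
    rw [← norm_prod, ← h]
    simp [hζ.norm'_eq_one hδ.ne']
  · intro j _ hj
    rw [Polynomial.eval_mul, Polynomial.eval_prod,
      prod_eq_zero (i := i) (mem_erase.2 ⟨hj.symm, mem_range.2 hi⟩) (by simp), zero_mul]

/-! ### Periodic subsets of `{1, …, n}` -/

/-- The union of the translates of `T` by `0, m, …, (δ - 1) m`. -/
def translatesUnion (δ m : ℕ) (T : Finset ℕ) : Finset ℕ :=
  (range δ).biUnion fun i => T.image fun s => s + i * m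

theorem mem_translatesUnion {δ m x : ℕ} {T : Finset ℕ} :
    x ∈ translatesUnion δ m T ↔ ∃ i < δ, ∃ t ∈ T, t + i * m = x := by
  simp [translatesUnion]

theorem add_mul_inj_of_mem_Icc {m s t i j : ℕ} (hs : s ∈ Icc 1 m) (ht : t ∈ Icc 1 m)
    (h : s + i * m = t + j * m) : s = t ∧ i = j := by
  rw [mem_Icc] at hs ht
  have hij : i = j := by
    rcases lt_trichotomy i j with hlt | rfl | hlt
    · nlinarith
    · rfl
    · nlinarith
  subst hij
  exact ⟨by omega, rfl⟩

theorem prod_translatesUnion {M : Type*} [CommMonoid M] {δ m : ℕ} {T : Finset ℕ}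
    (hT : T ⊆ Icc 1 m) (F : ℕ → M) :
    ∏ s ∈ translatesUnion δ m T, F s = ∏ t ∈ T, ∏ i ∈ range δ, F (t + i * m) := by
  rw [translatesUnion, prod_biUnion, prod_comm]
  · refine prod_congr rfl fun i _ => prod_image fun s _ t _ h => ?_
    simpa using h
  · intro i _ j _ hij
    rw [Function.onFun, disjoint_left]
    intro x hx hy
    obtain ⟨s, hs, rfl⟩ := mem_image.1 hx
    obtain ⟨t, ht, h⟩ := mem_image.1 hy
    exact hij (add_mul_inj_of_mem_Icc (hT ht) (hT hs) h).2.symm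

theorem card_translatesUnion {δ m : ℕ} {T : Finset ℕ} (hT : T ⊆ Icc 1 m) :
    (translatesUnion δ m T).card = δ * T.card := by
  have h := prod_translatesUnion (M := Multiplicative ℕ) (δ := δ) hT fun _ => Multiplicative.ofAdd 1
  simp only [prod_const, card_range, ← pow_mul] at h
  simpa using congrArg Multiplicative.toAdd h

theorem translatesUnion_subset {δ m : ℕ} {T : Finset ℕ} (hT : T ⊆ Icc 1 m) :
    translatesUnion δ m T ⊆ Icc 1 (δ * m) := by
  intro x hx
  obtain ⟨i, hi, t, ht, rfl⟩ := mem_translatesUnion.1 hx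
  have := mem_Icc.1 (hT ht)
  have : (i + 1) * m ≤ δ * m := Nat.mul_le_mul_right m hi
  rw [mem_Icc]
  constructor
  · omega
  · nlinarith

theorem translatesUnion_inter_Icc {δ m : ℕ} (hδ : 0 < δ) {T : Finset ℕ} (hT : T ⊆ Icc 1 m) :
    translatesUnion δ m T ∩ Icc 1 m = T := by
  ext x
  rw [mem_inter, mem_translatesUnion]
  constructor
  · rintro ⟨⟨i, -, t, ht, h⟩, hx⟩
    have := (add_mul_inj_of_mem_Icc (j := 0) (hT ht) hx (by simpa using h)).1
    exact this ▸ ht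
  · intro hx
    exact ⟨⟨0, hδ, x, hx, by simp⟩, hT hx⟩

/-- The indicator predicate on `ℤ` of the residues modulo `n` of elements of `S`. -/
def MemModulo (n : ℕ) (S : Finset ℕ) (x : ℤ) : Prop :=
  ∃ s ∈ S, (s : ℤ) ≡ x [ZMOD n]

theorem memModulo_periodic (n : ℕ) (S : Finset ℕ) : Function.Periodic (MemModulo n S) n := by
  intro x
  have : x + n ≡ x [ZMOD n] := by simp
  exact propext ⟨fun ⟨s, hs, h⟩ => ⟨s, hs, h.trans this⟩,
    fun ⟨s, hs, h⟩ => ⟨s, hs, h.trans this.symm⟩⟩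

theorem memModulo_natCast {n : ℕ} {S : Finset ℕ} (hS : S ⊆ Icc 1 n) {x : ℕ} (hx : x ∈ Icc 1 n) :
    MemModulo n S x ↔ x ∈ S := by
  refine ⟨?_, fun h => ⟨x, h, rfl⟩⟩
  rintro ⟨s, hs, h⟩
  have hs' := mem_Icc.1 (hS hs)
  rw [mem_Icc] at hx
  obtain ⟨c, hc⟩ := h.dvd
  have hc1 : c < 1 := by
    by_contra hcon
    have : 1 ≤ c := by omega
    nlinarith
  have hc2 : -1 < c := by
    by_contra hcon
    have : c ≤ -1 := by omega
    nlinarith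
  have hc0 : c = 0 := by omega
  rw [hc0, mul_zero] at hc
  have : x = s := by omega
  exact this ▸ hs

theorem memModulo_translatesUnion {δ m : ℕ} (hδ : 0 < δ) (T : Finset ℕ) :
    MemModulo (δ * m) (translatesUnion δ m T) = MemModulo m T := by
  ext x
  constructor
  · rintro ⟨s, hs, h⟩
    obtain ⟨i, -, t, ht, rfl⟩ := mem_translatesUnion.1 hs
    refine ⟨t, ht, ?_⟩
    have h' : ((t + i * m : ℕ) : ℤ) ≡ x [ZMOD m] :=
      Int.ModEq.of_dvd (by push_cast; exact dvd_mul_left _ _) h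
    refine Int.ModEq.trans ?_ h'
    push_cast
    exact (Int.modEq_iff_dvd.2 ⟨i, by ring⟩)
  · rintro ⟨t, ht, h⟩
    obtain ⟨c, hc⟩ := h.dvd
    have hδ' : (0 : ℤ) < δ := by exact_mod_cast hδ
    have hnn := Int.emod_nonneg c hδ'.ne'
    have hlt := Int.emod_lt_of_pos c hδ'
    obtain ⟨i, hi⟩ := Int.eq_ofNat_of_zero_le hnn
    refine ⟨t + i * m, mem_translatesUnion.2 ⟨i, by omega, t, ht, rfl⟩, ?_⟩
    refine Int.modEq_iff_dvd.2 ⟨c / δ, ?_⟩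
    have := Int.emod_add_mul_ediv c δ
    push_cast
    rw [hi] at this
    linear_combination hc - (m : ℤ) * this

theorem translatesUnion_inter_of_periodic {δ m : ℕ} {S : Finset ℕ}
    (hS : S ⊆ Icc 1 (δ * m)) (h : Function.Periodic (MemModulo (δ * m) S) m) :
    translatesUnion δ m (S ∩ Icc 1 m) = S := by
  have step (t i : ℕ) : MemModulo (δ * m) S ((t + i * m : ℕ) : ℤ) = MemModulo (δ * m) S t := by
    have := h.nat_mul i (t : ℤ)
    push_cast
    exact this
  ext x
  rw [mem_translatesUnion]
  constructor
  · rintro ⟨i, hi, t, ht, rfl⟩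
    obtain ⟨htS, htm⟩ := mem_inter.1 ht
    have hmem := translatesUnion_subset (δ := δ) (inter_subset_right (s₁ := S) (s₂ := Icc 1 m))
      (mem_translatesUnion.2 ⟨i, hi, t, ht, rfl⟩)
    rw [← memModulo_natCast hS hmem, step]
    exact (memModulo_natCast hS (hS htS)).2 htS
  · intro hx
    have hx' := mem_Icc.1 (hS hx)
    have hm : 0 < m := Nat.pos_of_ne_zero fun h0 => by simp [h0] at hx'; omega
    have hmod := Nat.mod_add_div (x - 1) m
    have hlt := Nat.mod_lt (x - 1) hm
    have hq : (x - 1) / m < δ := (Nat.div_lt_iff_lt_mul hm).2 (by omega)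
    have hxt : (x - 1) % m + 1 + (x - 1) / m * m = x := by
      rw [mul_comm ((x - 1) / m)]
      omega
    have hIcc : (x - 1) % m + 1 ∈ Icc 1 m := mem_Icc.2 ⟨by omega, by omega⟩
    have hIcc' : (x - 1) % m + 1 ∈ Icc 1 (δ * m) :=
      mem_Icc.2 ⟨by omega, by omega⟩
    refine ⟨(x - 1) / m, hq, (x - 1) % m + 1, mem_inter.2 ⟨?_, hIcc⟩, hxt⟩
    rw [← memModulo_natCast hS hIcc', ← step _ ((x - 1) / m), hxt]
    exact (memModulo_natCast hS (hS hx)).2 hx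

/-! ### Coperiods -/

theorem isCoperiod_iff_periodic {r k δ : ℕ} (hr : 0 < r) {S : Finset ℕ}
    (hS : S ∈ (Icc 1 (r + k)).powersetCard r) :
    IsCoperiod r k δ S ↔
      δ ∣ Nat.gcd r k ∧ Function.Periodic (MemModulo (r + k) S) (((r + k) / δ : ℕ) : ℤ) := by
  obtain ⟨hSsub, hScard⟩ := mem_powersetCard.1 hS
  refine and_congr_right fun hδ => ?_
  have hδr : δ ∣ r := hδ.trans (Nat.gcd_dvd_left r k)
  have hδ0 : 0 < δ := Nat.pos_of_dvd_of_pos hδr hr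
  have hn : δ * ((r + k) / δ) = r + k :=
    Nat.mul_div_cancel' (dvd_add hδr (hδ.trans (Nat.gcd_dvd_right r k)))
  constructor
  · rintro ⟨T, -, -, hST⟩
    have h := memModulo_translatesUnion (m := (r + k) / δ) hδ0 T
    rw [hn] at h
    rw [hST]
    exact h ▸ memModulo_periodic _ T
  · intro h
    rw [← hn] at hSsub
    have hU := translatesUnion_inter_of_periodic hSsub (by rw [hn]; exact h)
    refine ⟨S ∩ Icc 1 ((r + k) / δ), inter_subset_right, ?_, hU.symm⟩
    have hcard := card_translatesUnion (δ := δ) (inter_subset_right (s₁ := S)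
      (s₂ := Icc 1 ((r + k) / δ)))
    rw [hU, hScard] at hcard
    exact (Nat.div_eq_of_eq_mul_right hδ0 hcard).symm

theorem IsCoperiod.of_dvd {r k δ ε : ℕ} (hr : 0 < r) {S : Finset ℕ}
    (hS : S ∈ (Icc 1 (r + k)).powersetCard r) (h : IsCoperiod r k δ S) (hε : ε ∣ δ) :
    IsCoperiod r k ε S := by
  rw [isCoperiod_iff_periodic hr hS] at h ⊢
  refine ⟨hε.trans h.1, ?_⟩
  have hδn : δ ∣ r + k :=
    dvd_add (h.1.trans (Nat.gcd_dvd_left r k)) (h.1.trans (Nat.gcd_dvd_right r k))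
  obtain ⟨c, hc⟩ : (r + k) / δ ∣ (r + k) / ε := Nat.div_dvd_div_left hδn hε
  rw [hc, mul_comm, Nat.cast_mul]
  exact h.2.nat_mul c

theorem IsCoperiod.lcm {r k δ ε : ℕ} (hr : 0 < r) {S : Finset ℕ}
    (hS : S ∈ (Icc 1 (r + k)).powersetCard r) (hδ : IsCoperiod r k δ S)
    (hε : IsCoperiod r k ε S) : IsCoperiod r k (Nat.lcm δ ε) S := by
  rw [isCoperiod_iff_periodic hr hS] at hδ hε ⊢
  have hL : Nat.lcm δ ε ∣ Nat.gcd r k := Nat.lcm_dvd hδ.1 hε.1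
  refine ⟨hL, ?_⟩
  obtain ⟨q, hq⟩ : Nat.lcm δ ε ∣ r + k :=
    dvd_add (hL.trans (Nat.gcd_dvd_left r k)) (hL.trans (Nat.gcd_dvd_right r k))
  have hL0 : 0 < Nat.lcm δ ε := Nat.pos_of_dvd_of_pos (hL.trans (Nat.gcd_dvd_left r k)) hr
  have hδ0 : 0 < δ := Nat.pos_of_dvd_of_pos (Nat.dvd_lcm_left δ ε) hL0
  have hε0 : 0 < ε := Nat.pos_of_dvd_of_pos (Nat.dvd_lcm_right δ ε) hL0
  have hgcd : Nat.gcd ((r + k) / δ) ((r + k) / ε) = (r + k) / Nat.lcm δ ε := by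
    have hG0 : 0 < Nat.gcd δ ε := Nat.gcd_pos_of_pos_left ε hδ0
    have hδL : Nat.lcm δ ε = δ * (ε / Nat.gcd δ ε) := Nat.mul_div_assoc _ (Nat.gcd_dvd_right δ ε)
    have hεL : Nat.lcm δ ε = ε * (δ / Nat.gcd δ ε) := by
      rw [Nat.lcm_comm, Nat.gcd_comm]
      exact Nat.mul_div_assoc _ (Nat.gcd_dvd_right ε δ)
    have h₁ : (r + k) / δ = ε / Nat.gcd δ ε * q := by
      rw [hq, hδL, mul_assoc, Nat.mul_div_cancel_left _ hδ0]
    have h₂ : (r + k) / ε = δ / Nat.gcd δ ε * q := by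
      rw [hq, hεL, mul_assoc, Nat.mul_div_cancel_left _ hε0]
    rw [h₁, h₂, Nat.gcd_mul_right, Nat.gcd_comm, Nat.coprime_div_gcd_div_gcd hG0, one_mul, hq,
      Nat.mul_div_cancel_left _ hL0]
  rw [← hgcd, Nat.gcd_eq_gcd_ab, mul_comm, mul_comm (((r + k) / ε : ℕ) : ℤ)]
  exact (hδ.2.int_mul _).add_period (hε.2.int_mul _)

theorem isCoperiod_iff_dvd_largestCoperiod {r k δ : ℕ} (hr : 0 < r) {S : Finset ℕ}
    (hS : S ∈ (Icc 1 (r + k)).powersetCard r) :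
    IsCoperiod r k δ S ↔ δ ∣ largestCoperiod r k S := by
  have hG : 0 < Nat.gcd r k := Nat.gcd_pos_of_pos_left k hr
  have hone : IsCoperiod r k 1 S := by
    rw [isCoperiod_iff_periodic hr hS]
    exact ⟨one_dvd _, by simpa using memModulo_periodic (r + k) S⟩
  have hmax : IsCoperiod r k (largestCoperiod r k S) S :=
    Nat.findGreatest_spec (P := fun δ => IsCoperiod r k δ S) hG hone
  refine ⟨fun h => ?_, hmax.of_dvd hr hS⟩
  have hlcm := h.lcm hr hS hmax
  have hle : Nat.lcm δ (largestCoperiod r k S) ≤ largestCoperiod r k S :=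
    Nat.le_findGreatest (Nat.le_of_dvd hG hlcm.1) hlcm
  have heq : Nat.lcm δ (largestCoperiod r k S) = largestCoperiod r k S :=
    le_antisymm hle (Nat.le_of_dvd (Nat.pos_of_dvd_of_pos hlcm.1 hG) (Nat.dvd_lcm_right _ _))
  exact heq ▸ Nat.dvd_lcm_left δ (largestCoperiod r k S)

/-! ### Sine products of periodic sets -/

/-- The product of `|2 sin ((s - t) π / n)|` over ordered pairs of distinct elements of `S`. -/
noncomputable def sineProd (n : ℕ) (S : Finset ℕ) : ℝ :=
  ∏ p ∈ (S ×ˢ S).filter (fun p => p.1 ≠ p.2),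
    |2 * Real.sin (((p.1 : ℝ) - (p.2 : ℝ)) * Real.pi / n)|

theorem sineProd_eq_prod_prod (n : ℕ) (S : Finset ℕ) :
    sineProd n S = ∏ s ∈ S, ∏ t ∈ S,
      if s ≠ t then |2 * Real.sin (((s : ℝ) - t) * Real.pi / n)| else 1 := by
  rw [sineProd, prod_filter, prod_product]

theorem prod_range_abs_two_mul_sin_translate {δ m s t i : ℕ} (hs : s ∈ Icc 1 m)
    (ht : t ∈ Icc 1 m) (hi : i < δ) :
    (∏ j ∈ range δ, if s + i * m ≠ t + j * m then
        |2 * Real.sin ((((s + i * m : ℕ) : ℝ) - ((t + j * m : ℕ) : ℝ)) * Real.pi / (δ * m : ℕ))|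
      else 1) = if s ≠ t then |2 * Real.sin (((s : ℝ) - t) * Real.pi / m)| else (δ : ℝ) := by
  have hδ : 0 < δ := by omega
  have hδ' : (δ : ℝ) ≠ 0 := by exact_mod_cast hδ.ne'
  have hm' : (m : ℝ) ≠ 0 := by
    have := mem_Icc.1 hs
    exact_mod_cast (by omega : m ≠ 0)
  have harg (j : ℕ) :
      (((s + i * m : ℕ) : ℝ) - ((t + j * m : ℕ) : ℝ)) * Real.pi / (δ * m : ℕ) =
        ((s : ℝ) - t) * Real.pi / (δ * m) + i * Real.pi / δ - j * Real.pi / δ := by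
    push_cast
    field_simp
    ring
  simp only [harg]
  split_ifs with hst
  · have hall (j : ℕ) : s + i * m ≠ t + j * m :=
      fun h => hst (add_mul_inj_of_mem_Icc hs ht h).1
    simp only [ne_eq, hall, not_false_eq_true, if_true]
    rw [prod_range_abs_two_mul_sin_sub hδ]
    have hy : (δ : ℝ) * (((s : ℝ) - t) * Real.pi / (δ * m) + i * Real.pi / δ) =
        ((s : ℝ) - t) * Real.pi / m + i * Real.pi := by
      field_simp
    rw [hy, Real.sin_add_nat_mul_pi, abs_mul, abs_mul, abs_mul, abs_pow, abs_neg, abs_one, one_pow,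
      one_mul]
  · obtain rfl : s = t := not_not.1 hst
    rw [← mul_prod_erase _ _ (mem_range.2 hi), if_neg (by simp), one_mul]
    refine Eq.trans ?_ (prod_range_erase_abs_two_mul_sin hi)
    refine prod_congr rfl fun j hj => ?_
    rw [if_pos fun h => (ne_of_mem_erase hj) (add_mul_inj_of_mem_Icc hs hs h).2.symm]
    simp

theorem sineProd_translatesUnion {δ m : ℕ} {T : Finset ℕ} (hT : T ⊆ Icc 1 m) :
    sineProd (δ * m) (translatesUnion δ m T) = (δ : ℝ) ^ (δ * T.card) * sineProd m T ^ δ := by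
  have hinner (s : ℕ) (hs : s ∈ T) (i : ℕ) (hi : i ∈ range δ) :
      (∏ t ∈ T, ∏ j ∈ range δ, if s + i * m ≠ t + j * m then
        |2 * Real.sin ((((s + i * m : ℕ) : ℝ) - ((t + j * m : ℕ) : ℝ)) * Real.pi / (δ * m : ℕ))|
      else 1) =
        δ * ∏ t ∈ T, if s ≠ t then |2 * Real.sin (((s : ℝ) - t) * Real.pi / m)| else 1 := by
    rw [prod_congr rfl fun t ht =>
      prod_range_abs_two_mul_sin_translate (hT hs) (hT ht) (mem_range.1 hi)]
    rw [← mul_prod_erase _ _ hs, ← mul_prod_erase T (fun t => ite (s ≠ t) _ _) hs]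
    simp only [ne_eq, not_true_eq_false, if_false, one_mul]
    congr 1
    refine prod_congr rfl fun t ht => ?_
    rw [if_pos (ne_of_mem_erase ht).symm, if_pos (ne_of_mem_erase ht).symm]
  rw [sineProd_eq_prod_prod, sineProd_eq_prod_prod, prod_translatesUnion hT]
  simp only [prod_translatesUnion hT]
  rw [prod_congr rfl fun s hs => prod_congr rfl (hinner s hs)]
  simp only [prod_const, card_range, mul_pow, prod_mul_distrib, prod_pow, ← pow_mul]

theorem prod_zpow_eq_sineProd (r k : ℕ) (S : Finset ℕ) (e : ℤ) :
    ∏ p ∈ (S ×ˢ S).filter (fun p => p.1 ≠ p.2),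
        |2 * Real.sin (((p.1 : ℝ) - (p.2 : ℝ)) * Real.pi / ((r : ℝ) + k))| ^ e =
      sineProd (r + k) S ^ e := by
  rw [prod_zpow, sineProd]
  push_cast
  rfl

theorem verlinde_div {g r k δ : ℕ} (hg : 1 ≤ g) (hr : 0 < r) (hδ : δ ∣ Nat.gcd r k) :
    verlinde (δ * (g - 1) + 1) (r / δ) (k / δ) =
      ((r : ℝ) + k) ^ (r * (g - 1)) *
        ∑ S ∈ ((Icc 1 (r + k)).powersetCard r).filter (IsCoperiod r k δ),
          sineProd (r + k) S ^ (1 - (g : ℤ)) := by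
  obtain ⟨a, ha⟩ : δ ∣ r := hδ.trans (Nat.gcd_dvd_left r k)
  obtain ⟨b, hb⟩ : δ ∣ k := hδ.trans (Nat.gcd_dvd_right r k)
  have hδ0 : 0 < δ := Nat.pos_of_dvd_of_pos ⟨a, ha⟩ hr
  have hra : r / δ = a := by rw [ha, Nat.mul_div_cancel_left _ hδ0]
  have hkb : k / δ = b := by rw [hb, Nat.mul_div_cancel_left _ hδ0]
  have hn : r + k = δ * (a + b) := by rw [ha, hb, mul_add]
  have hm : (r + k) / δ = a + b := by rw [hn, Nat.mul_div_cancel_left _ hδ0]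
  obtain ⟨h, rfl⟩ : ∃ h, g = h + 1 := ⟨g - 1, by omega⟩
  have he : (1 - ((δ * h + 1 : ℕ) : ℤ)) = -((δ * h : ℕ) : ℤ) := by push_cast; ring
  have he' : (1 - ((h + 1 : ℕ) : ℤ)) = -(h : ℤ) := by push_cast; ring
  have hδ' : (δ : ℝ) ≠ 0 := by exact_mod_cast hδ0.ne'
  have hnR : (r : ℝ) + k = δ * ((a : ℝ) + b) := by exact_mod_cast hn
  simp only [verlinde, Nat.add_sub_cancel, prod_zpow_eq_sineProd, hra, hkb, he, he']
  rw [mul_sum, mul_sum]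
  refine sum_bij' (fun T _ => translatesUnion δ (a + b) T) (fun S _ => S ∩ Icc 1 (a + b))
    ?_ ?_ ?_ ?_ ?_
  · intro T hT
    obtain ⟨hT, hTa⟩ := mem_powersetCard.1 hT
    refine mem_filter.2 ⟨mem_powersetCard.2 ⟨hn ▸ translatesUnion_subset hT, ?_⟩, hδ, T, ?_, ?_, ?_⟩
    · rw [card_translatesUnion hT, hTa, ha]
    · rwa [hm]
    · rw [hra, hTa]
    · rw [hm]
      rfl
  · intro S hS
    obtain ⟨-, -, T, hT, hTa, rfl⟩ := mem_filter.1 hS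
    rw [hm] at hT
    have := translatesUnion_inter_Icc hδ0 hT
    rw [translatesUnion] at this
    simp only [hm]
    rw [this, mem_powersetCard]
    exact ⟨hT, hTa.trans hra⟩
  · intro T hT
    exact translatesUnion_inter_Icc hδ0 (mem_powersetCard.1 hT).1
  · intro S hS
    obtain ⟨hS, hco⟩ := mem_filter.1 hS
    have hper := ((isCoperiod_iff_periodic hr hS).1 hco).2
    rw [hm, hn] at hper
    exact translatesUnion_inter_of_periodic (hn ▸ (mem_powersetCard.1 hS).1) hper
  · intro T hT
    obtain ⟨hT, hTa⟩ := mem_powersetCard.1 hT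
    simp only [zpow_neg, zpow_natCast]
    rw [hn, sineProd_translatesUnion hT, hnR, hTa, ← ha, mul_pow, mul_pow, mul_inv, ← pow_mul,
      ← pow_mul, ← mul_assoc a, mul_comm a δ, ← ha]
    have : (δ : ℝ) ^ (r * h) ≠ 0 := pow_ne_zero _ hδ'
    field_simp

/-- The combinatorial content of the Verlinde formula for `SL_r/Z_d`:
`(1/d^{2g}) · (r^g/(r+k)^g) · ∑_{δ ∣ d} n_g(δ) · v_{δ(g−1)+1}(r/δ, k/δ)` equals
`r^g (r+k)^{(r−1)(g−1)−1} ∑_S (gcd(δ_S,d)/d)^{2g} ∏_{s ≠ t ∈ S} |2 sin((s−t)π/(r+k))|^{1−g}`. -/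
theorem verlinde_nonsimplyconnected (g r k d : ℕ) (hg : 1 ≤ g) (hr : 0 < r) (hk : 0 < k)
    (hd : 0 < d) (hdvd : d ∣ Nat.gcd r k) :
    (1 / (d : ℝ) ^ (2 * g)) * ((r : ℝ) ^ g / ((r : ℝ) + k) ^ g) *
        ∑ δ ∈ d.divisors, jordanCount g δ * verlinde (δ * (g - 1) + 1) (r / δ) (k / δ) =
      (r : ℝ) ^ g * ((r : ℝ) + k) ^ (((r : ℤ) - 1) * ((g : ℤ) - 1) - 1) *
        ∑ S ∈ (Finset.Icc 1 (r + k)).powersetCard r,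
          ((Nat.gcd (largestCoperiod r k S) d : ℝ) / d) ^ (2 * g) *
            ∏ p ∈ (S ×ˢ S).filter (fun p => p.1 ≠ p.2),
              |2 * Real.sin (((p.1 : ℝ) - (p.2 : ℝ)) * Real.pi / ((r : ℝ) + k))| ^
                (1 - (g : ℤ)) := by
  have hn : ((r : ℝ) + k) ≠ 0 := by positivity
  have hd' : (d : ℝ) ≠ 0 := by positivity
  have hsum : ∑ δ ∈ d.divisors, jordanCount g δ * verlinde (δ * (g - 1) + 1) (r / δ) (k / δ) =
      ((r : ℝ) + k) ^ (r * (g - 1)) * ∑ S ∈ (Finset.Icc 1 (r + k)).powersetCard r,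
        (Nat.gcd (largestCoperiod r k S) d : ℝ) ^ (2 * g) *
          sineProd (r + k) S ^ (1 - (g : ℤ)) := by
    have hterm (δ : ℕ) (hδ : δ ∈ d.divisors) :
        jordanCount g δ * verlinde (δ * (g - 1) + 1) (r / δ) (k / δ) =
          ∑ S ∈ (Finset.Icc 1 (r + k)).powersetCard r, ((r : ℝ) + k) ^ (r * (g - 1)) *
            if δ ∣ largestCoperiod r k S then
              jordanCount g δ * sineProd (r + k) S ^ (1 - (g : ℤ)) else 0 := by
      rw [verlinde_div hg hr ((Nat.dvd_of_mem_divisors hδ).trans hdvd), sum_filter, mul_left_comm,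
        mul_sum, mul_sum]
      refine sum_congr rfl fun S hS => ?_
      simp only [isCoperiod_iff_dvd_largestCoperiod hr hS, mul_ite, mul_zero]
    rw [sum_congr rfl hterm, sum_comm, mul_sum]
    refine sum_congr rfl fun S hS => ?_
    rw [← mul_sum, ← sum_filter, ← sum_mul,
      ← sum_divisors_jordanCount hg]
    congr 3
    ext δ
    simp [Nat.dvd_gcd_iff, hd.ne', and_comm]
  have hexp : ((r : ℝ) + k) ^ (((r : ℤ) - 1) * ((g : ℤ) - 1) - 1) =
      ((r : ℝ) + k) ^ (r * (g - 1)) / ((r : ℝ) + k) ^ g := by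
    rw [← zpow_natCast, ← zpow_natCast, ← zpow_sub₀ hn]
    congr 1
    push_cast [Nat.cast_sub hg]
    ring
  rw [hsum, hexp]
  simp only [prod_zpow_eq_sineProd, div_pow, div_mul_eq_mul_div, ← sum_div]
  field_simp
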